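/- arXiv:2404.17256 — 2 statements merged into one kernel-verified Lean document; each statement's English description precedes it below -/
import Mathlib

section
/- Let G be a finite abelian group, k a field whose characteristic does not divide |G|, and χ₁,…,χ_N : G → kˣ characters, with G acting diagonally on k[x₁,…,x_N] by g·x_i = χ_i(g)x_i. For a positive integer d, the points of L(G,V) of degree at most d generate L(G,V) as a group if and only if the set k(V)^G_{≤d} of G-invariant rational functions of degree at most d generates the invariant field k(V)^G as a field extension of k. -/
open MvPolynomial

noncomputable section

variable {k : Type} [Field k] {N : ℕ} {G : Type}

def mAct (M : Matrix (Fin N) (Fin N) k) :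
    MvPolynomial (Fin N) k →ₐ[k] MvPolynomial (Fin N) k :=
  aeval fun i => ∑ j, C (M i j) * X j

lemma mAct_comp (A B : Matrix (Fin N) (Fin N) k) :
    (mAct A).comp (mAct B) = mAct (B * A) := by
  apply MvPolynomial.algHom_ext
  intro i
  simp only [mAct, AlgHom.comp_apply, aeval_X, map_sum, map_mul, aeval_C, algebraMap_eq,
    Finset.mul_sum, Matrix.mul_apply, Finset.sum_mul]
  rw [Finset.sum_comm]
  simp [mul_assoc]

lemma mAct_one : mAct (1 : Matrix (Fin N) (Fin N) k) = AlgHom.id k _ := by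
  apply MvPolynomial.algHom_ext
  intro i
  simp [mAct, Matrix.one_apply, ite_mul, apply_ite C]

def mEquiv (M : GL (Fin N) k) :
    MvPolynomial (Fin N) k ≃ₐ[k] MvPolynomial (Fin N) k :=
  AlgEquiv.ofAlgHom (mAct (M : Matrix (Fin N) (Fin N) k))
    (mAct ((M⁻¹ : GL (Fin N) k) : Matrix (Fin N) (Fin N) k))
    (by rw [mAct_comp, Units.inv_mul, mAct_one])
    (by rw [mAct_comp, Units.mul_inv, mAct_one])

def fAct (M : GL (Fin N) k) :
    FractionRing (MvPolynomial (Fin N) k) ≃+* FractionRing (MvPolynomial (Fin N) k) :=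
  IsFractionRing.ringEquivOfRingEquiv (mEquiv M).toRingEquiv

/-- `f` is an invariant rational function for the linear action `ρ`. -/
def IsInv (ρ : G → GL (Fin N) k) (f : FractionRing (MvPolynomial (Fin N) k)) : Prop :=
  ∀ g, fAct (ρ g) f = f

/-- `f`, written as a quotient `f₁/f₂` of coprime polynomials, has
`deg f = deg f₁ + deg f₂ ≤ d`. -/
def RDegLE (f : FractionRing (MvPolynomial (Fin N) k)) (d : ℕ) : Prop :=
  ∃ f₁ f₂ : MvPolynomial (Fin N) k, f₂ ≠ 0 ∧
    (∀ p : MvPolynomial (Fin N) k, p ∣ f₁ → p ∣ f₂ → IsUnit p) ∧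
    f = algebraMap (MvPolynomial (Fin N) k) (FractionRing (MvPolynomial (Fin N) k)) f₁ /
        algebraMap (MvPolynomial (Fin N) k) (FractionRing (MvPolynomial (Fin N) k)) f₂ ∧
    f₁.totalDegree + f₂.totalDegree ≤ d

/-- `f` is (the image in `k(V)` of) a polynomial of degree at most `d`. -/
def PDegLE (f : FractionRing (MvPolynomial (Fin N) k)) (d : ℕ) : Prop :=
  ∃ p : MvPolynomial (Fin N) k, p.totalDegree ≤ d ∧
    f = algebraMap (MvPolynomial (Fin N) k) (FractionRing (MvPolynomial (Fin N) k)) p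

/-- `β^r(G,V)`: the least `d` such that the invariant rational functions of degree at most `d`
generate the invariant field over `k`. -/
def betaR (ρ : G → GL (Fin N) k) : ℕ :=
  sInf {d : ℕ | ∀ f, IsInv ρ f →
    f ∈ IntermediateField.adjoin k {h | IsInv ρ h ∧ RDegLE h d}}

/-- `β(G,V)`: the least `d` such that the invariant polynomials of degree at most `d`
generate the invariant field over `k`. -/
def betaP (ρ : G → GL (Fin N) k) : ℕ :=
  sInf {d : ℕ | ∀ f, IsInv ρ f →
    f ∈ IntermediateField.adjoin k {h | IsInv ρ h ∧ PDegLE h d}}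

/-- `γ^r(G,V)`: the least `d` such that the invariant rational functions of degree at most `d`
contain a transcendence basis for the invariant field over `k`. -/
def gammaR (ρ : G → GL (Fin N) k) : ℕ :=
  sInf {d : ℕ | ∃ s : Set (FractionRing (MvPolynomial (Fin N) k)),
    (∀ f ∈ s, IsInv ρ f ∧ RDegLE f d) ∧
    AlgebraicIndependent k ((↑) : s → FractionRing (MvPolynomial (Fin N) k)) ∧
    ∀ f, IsInv ρ f → IsAlgebraic (IntermediateField.adjoin k s) f}

/-- `γ(G,V)`: the least `d` such that the invariant polynomials of degree at most `d`
contain a transcendence basis for the invariant field over `k`. -/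
def gammaP (ρ : G → GL (Fin N) k) : ℕ :=
  sInf {d : ℕ | ∃ s : Set (FractionRing (MvPolynomial (Fin N) k)),
    (∀ f ∈ s, IsInv ρ f ∧ PDegLE f d) ∧
    AlgebraicIndependent k ((↑) : s → FractionRing (MvPolynomial (Fin N) k)) ∧
    ∀ f, IsInv ρ f → IsAlgebraic (IntermediateField.adjoin k s) f}

variable [CommGroup G]

/-- The invertible diagonal matrix with units `c i` on the diagonal. -/
def diagGL (c : Fin N → kˣ) : GL (Fin N) k :=
  ⟨Matrix.diagonal fun i => (c i : k), Matrix.diagonal fun i => ((c i)⁻¹ : kˣ),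
   by simp [Matrix.diagonal_mul_diagonal], by simp [Matrix.diagonal_mul_diagonal]⟩

/-- The diagonal linear action of `G` attached to a tuple of characters `χ i : G →* kˣ`:
`g` acts by scaling the `i`-th coordinate by `χ i g`. -/
def diagρ (χ : Fin N → (G →* kˣ)) : G → GL (Fin N) k :=
  fun g => diagGL fun i => χ i g

/-- The exponent vector `a ∈ ℤᴺ` lies in the lattice `L(G,V)` of exponent vectors of
`G`-invariant Laurent monomials. -/
def inLat (χ : Fin N → (G →* kˣ)) (a : Fin N → ℤ) : Prop :=
  ∀ g, ∏ i, (χ i g) ^ (a i) = 1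

/-- The degree (`L¹`-norm) of an exponent vector. -/
def degZ (a : Fin N → ℤ) : ℕ := ∑ i, (a i).natAbs

/-- The Laurent monomial `x^a ∈ k(x₁,…,x_N)` with exponent vector `a : Fin N → ℤ`. -/
def laur (a : Fin N → ℤ) : FractionRing (MvPolynomial (Fin N) k) :=
  ∏ i, (algebraMap (MvPolynomial (Fin N) k) (FractionRing (MvPolynomial (Fin N) k)) (X i)) ^ (a i)

/-- The lattice `L(G,V)` as an additive subgroup of `ℤᴺ`. -/
def latgrp (χ : Fin N → (G →* kˣ)) : AddSubgroup (Fin N → ℤ) where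
  carrier := {a | inLat χ a}
  zero_mem' := by intro g; simp
  add_mem' := by
    intro a b ha hb g
    simp only [Pi.add_apply, zpow_add]
    rw [Finset.prod_mul_distrib, ha g, hb g, mul_one]
  neg_mem' := by
    intro a ha g
    simp only [Pi.neg_apply, zpow_neg]
    rw [Finset.prod_inv_distrib, ha g, inv_one]

/-- Exponent vector as an integer vector. -/
def zv (m : Fin N →₀ ℕ) : Fin N → ℤ := fun i => (m i : ℤ)

lemma zv_add (m n : Fin N →₀ ℕ) : zv (m + n) = zv m + zv n := by
  ext i; simp [zv]

/-- Character of a monomial. -/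
def psi (χ : Fin N → (G →* kˣ)) (g : G) (m : Fin N →₀ ℕ) : kˣ := ∏ i, (χ i g) ^ (m i)

lemma mAct_monomial (χ : Fin N → (G →* kˣ)) (g : G) (m : Fin N →₀ ℕ) (c : k) :
    mEquiv (diagρ χ g) (monomial m c) = monomial m ((psi χ g m : k) * c) := by
  have h : ∀ i, (∑ j, C ((diagρ χ g : Matrix (Fin N) (Fin N) k) i j) * X j : MvPolynomial (Fin N) k)
      = C (χ i g : k) * X i := by
    intro i
    rw [Finset.sum_eq_single i]
    · simp [diagρ, diagGL]
    · intro j _ hj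
      simp [diagρ, diagGL, Matrix.diagonal_apply_ne _ hj.symm]
    · simp
  change mAct _ _ = _
  rw [mAct, aeval_monomial]
  simp only [h]
  rw [Finsupp.prod_fintype _ _ (by simp)]
  simp only [mul_pow, Finset.prod_mul_distrib]
  rw [monomial_eq (s := m) (a := (psi χ g m : k) * c), Finsupp.prod_fintype _ _ (by simp)]
  simp only [psi, Units.coe_prod, Units.val_pow_eq_pow_val, algebraMap_eq, map_mul, map_prod, map_pow]
  ring

lemma coeff_mEquiv (χ : Fin N → (G →* kˣ)) (g : G) (p : MvPolynomial (Fin N) k) (m : Fin N →₀ ℕ) :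
    coeff m (mEquiv (diagρ χ g) p) = (psi χ g m : k) * coeff m p := by
  classical
  induction p using MvPolynomial.induction_on' with
  | monomial u a =>
    rw [mAct_monomial]
    simp only [coeff_monomial]
    split_ifs with h
    · rw [h]
    · simp
  | add p q hp hq => rw [map_add, coeff_add, hp, hq, coeff_add, mul_add]

lemma totalDegree_mEquiv_le (χ : Fin N → (G →* kˣ)) (g : G) (p : MvPolynomial (Fin N) k) :
    (mEquiv (diagρ χ g) p).totalDegree ≤ p.totalDegree := by
  refine Finset.sup_mono ?_
  intro m hm
  rw [mem_support_iff, coeff_mEquiv] at hm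
  rw [mem_support_iff]
  exact right_ne_zero_of_mul hm

lemma fAct_alg (M : GL (Fin N) k) (p : MvPolynomial (Fin N) k) :
    fAct M (algebraMap _ _ p) = algebraMap _ _ (mEquiv M p) := by
  simp [fAct]

lemma psi_eq_iff (χ : Fin N → (G →* kˣ)) (m n : Fin N →₀ ℕ) :
    inLat χ (zv m - zv n) ↔ ∀ g, psi χ g m = psi χ g n := by
  unfold inLat
  refine forall_congr' fun g => ?_
  simp only [psi, zv, Pi.sub_apply, zpow_sub, Finset.prod_mul_distrib, Finset.prod_inv_distrib,
    zpow_natCast]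
  exact mul_inv_eq_one

lemma key (χ : Fin N → (G →* kˣ)) (f : FractionRing (MvPolynomial (Fin N) k))
    (hf : IsInv (diagρ χ) f) (p q : MvPolynomial (Fin N) k) (hq : q ≠ 0)
    (hpq : ∀ r : MvPolynomial (Fin N) k, r ∣ p → r ∣ q → IsUnit r)
    (hfe : f = algebraMap (MvPolynomial (Fin N) k) (FractionRing (MvPolynomial (Fin N) k)) p /
        algebraMap (MvPolynomial (Fin N) k) (FractionRing (MvPolynomial (Fin N) k)) q)
    (m n : Fin N →₀ ℕ) (hm : m ∈ p.support ∨ m ∈ q.support)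
    (hn : n ∈ p.support ∨ n ∈ q.support) : inLat χ (zv m - zv n) := by
  rw [psi_eq_iff]
  intro g
  have hinj := IsFractionRing.injective (MvPolynomial (Fin N) k)
    (FractionRing (MvPolynomial (Fin N) k))
  have h0 : ∀ r : MvPolynomial (Fin N) k, r ≠ 0 →
      algebraMap (MvPolynomial (Fin N) k) (FractionRing (MvPolynomial (Fin N) k)) r ≠ 0 := by
    intro r hr h
    exact hr (hinj (by rw [h, map_zero]))
  have hgq : mEquiv (diagρ χ g) q ≠ 0 := by
    intro h
    exact hq ((mEquiv (diagρ χ g)).injective (by rw [h, map_zero]))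
  have e := hf g
  rw [hfe, map_div₀, fAct_alg, fAct_alg, div_eq_div_iff (h0 _ hgq) (h0 _ hq), ← map_mul,
    ← map_mul] at e
  have e := hinj e
  have hdvd : q ∣ mEquiv (diagρ χ g) q := by
    have h1 : IsRelPrime q p := fun r h1 h2 => hpq r h2 h1
    exact h1.dvd_of_dvd_mul_left ⟨mEquiv (diagρ χ g) p, by rw [← e, mul_comm]⟩
  obtain ⟨u, hu⟩ := hdvd
  have hu0 : u ≠ 0 := by
    rintro rfl
    exact hgq (by rw [hu, mul_zero])
  have hdeg := totalDegree_mEquiv_le χ g q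
  rw [hu, totalDegree_mul_of_isDomain hq hu0] at hdeg
  have huC : u = C (u.coeff 0) := totalDegree_eq_zero_iff_eq_C.mp (by omega)
  set c := u.coeff 0
  have hp : mEquiv (diagρ χ g) p = C c * p := by
    apply mul_right_cancel₀ hq
    rw [e, hu, huC]; ring
  have hq' : mEquiv (diagρ χ g) q = C c * q := by
    rw [hu, huC]; ring
  have aux : ∀ m : Fin N →₀ ℕ, m ∈ p.support ∨ m ∈ q.support → (psi χ g m : k) = c := by
    intro m hm
    rcases hm with hm | hm
    · have := congrArg (coeff m) hp
      rw [coeff_mEquiv, coeff_C_mul] at this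
      exact mul_right_cancel₀ (mem_support_iff.mp hm) this
    · have := congrArg (coeff m) hq'
      rw [coeff_mEquiv, coeff_C_mul] at this
      exact mul_right_cancel₀ (mem_support_iff.mp hm) this
  exact Units.ext ((aux m hm).trans (aux n hn).symm)

/-- Positive part. -/
def posP (a : Fin N → ℤ) : Fin N →₀ ℕ := Finsupp.equivFunOnFinite.symm fun i => (a i).toNat

lemma posP_apply (a : Fin N → ℤ) (i) : posP a i = (a i).toNat := by simp [posP]

lemma zv_posP_sub (a : Fin N → ℤ) : zv (posP a) - zv (posP (-a)) = a := by
  ext i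
  simp only [zv, Pi.sub_apply, posP_apply, Pi.neg_apply]
  omega

lemma algX_ne (i : Fin N) : algebraMap (MvPolynomial (Fin N) k)
    (FractionRing (MvPolynomial (Fin N) k)) (X i) ≠ 0 := by
  intro h
  exact X_ne_zero (R := k) i (IsFractionRing.injective (MvPolynomial (Fin N) k)
    (FractionRing (MvPolynomial (Fin N) k)) (by rw [h, map_zero]))

lemma laur_add (a b : Fin N → ℤ) : laur (k := k) (a + b) = laur a * laur b := by
  simp only [laur, Pi.add_apply]
  rw [← Finset.prod_mul_distrib]
  exact Finset.prod_congr rfl fun i _ => zpow_add₀ (algX_ne i) _ _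

lemma laur_neg (a : Fin N → ℤ) : laur (k := k) (-a) = (laur a)⁻¹ := by
  simp [laur]

lemma laur_ne (a : Fin N → ℤ) : laur (k := k) a ≠ 0 :=
  Finset.prod_ne_zero_iff.mpr fun i _ => zpow_ne_zero _ (algX_ne i)

lemma laur_zv (m : Fin N →₀ ℕ) : laur (k := k) (zv m) = algebraMap _ _ (monomial m (1 : k)) := by
  rw [monomial_eq, Finsupp.prod_fintype _ _ (by simp)]
  simp [laur, zv]

lemma laur_sub (a b : Fin N → ℤ) : laur (k := k) (a - b) = laur a / laur b := by
  rw [sub_eq_add_neg, laur_add, laur_neg, div_eq_mul_inv]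

lemma laur_eq (a : Fin N → ℤ) : laur (k := k) a =
    algebraMap _ _ (monomial (posP a) (1 : k)) / algebraMap _ _ (monomial (posP (-a)) (1 : k)) := by
  rw [← laur_zv, ← laur_zv, ← laur_sub, zv_posP_sub]

lemma laur_inv (χ : Fin N → (G →* kˣ)) (a : Fin N → ℤ) (ha : inLat χ a) :
    IsInv (diagρ χ) (laur a) := by
  intro g
  rw [← zv_posP_sub a, psi_eq_iff] at ha
  rw [laur_eq, map_div₀, fAct_alg, fAct_alg, mAct_monomial, mAct_monomial, ha g,
    ← C_mul_monomial, ← C_mul_monomial, map_mul, map_mul]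
  apply mul_div_mul_left
  intro h
  have := IsFractionRing.injective (MvPolynomial (Fin N) k)
    (FractionRing (MvPolynomial (Fin N) k)) (h.trans (map_zero _).symm)
  simp at this

lemma laur_deg (a : Fin N → ℤ) (d : ℕ) (ha : degZ a ≤ d) : RDegLE (laur (k := k) a) d := by
  refine ⟨monomial (posP a) 1, monomial (posP (-a)) 1, by simp, ?_, laur_eq a, ?_⟩
  · intro p h1 h2
    rw [dvd_monomial_one_iff_exists] at h1
    obtain ⟨m, u, hm, hu, rfl⟩ := h1
    rw [monomial_dvd_monomial] at h2
    have hm2 : m ≤ posP (-a) := by simpa using h2.1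
    have : m = 0 := by
      ext i
      have h3 := hm i
      have h4 := hm2 i
      simp only [posP_apply, Pi.neg_apply] at h3 h4
      simp only [Finsupp.coe_zero, Pi.zero_apply]
      omega
    subst this
    exact hu.map C
  · rw [totalDegree_monomial _ one_ne_zero, totalDegree_monomial _ one_ne_zero,
      Finsupp.sum_fintype _ _ (by simp), Finsupp.sum_fintype _ _ (by simp),
      ← Finset.sum_add_distrib]
    refine le_trans (le_of_eq ?_) ha
    refine Finset.sum_congr rfl fun i _ => ?_
    simp only [posP_apply, Pi.neg_apply]
    omega

lemma degZ_sub_le (m n : Fin N →₀ ℕ) (p q : MvPolynomial (Fin N) k) (hm : m ∈ p.support)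
    (hn : n ∈ q.support) : degZ (zv m - zv n) ≤ p.totalDegree + q.totalDegree := by
  have h1 := le_totalDegree hm
  have h2 := le_totalDegree hn
  rw [Finsupp.sum_fintype _ _ (by simp)] at h1 h2
  refine le_trans ?_ (add_le_add h1 h2)
  rw [← Finset.sum_add_distrib]
  refine Finset.sum_le_sum fun i _ => ?_
  simp only [zv, Pi.sub_apply]
  omega

/-- All exponents of `p` lie in the coset `c + Λ`. -/
def inCos (Λ : AddSubgroup (Fin N → ℤ)) (c : Fin N → ℤ) (p : MvPolynomial (Fin N) k) : Prop :=
  ∀ m ∈ p.support, zv m - c ∈ Λ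

lemma inCos_mul (Λ : AddSubgroup (Fin N → ℤ)) (c d : Fin N → ℤ) (p q : MvPolynomial (Fin N) k)
    (hp : inCos Λ c p) (hq : inCos Λ d q) : inCos Λ (c + d) (p * q) := by
  classical
  intro m hm
  obtain ⟨a, ha, b, hb, rfl⟩ := Finset.mem_add.mp (support_mul p q hm)
  rw [zv_add, add_sub_add_comm]
  exact Λ.add_mem (hp a ha) (hq b hb)

lemma inCos_add (Λ : AddSubgroup (Fin N → ℤ)) (c : Fin N → ℤ) (p q : MvPolynomial (Fin N) k)
    (hp : inCos Λ c p) (hq : inCos Λ c q) : inCos Λ c (p + q) := by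
  classical
  intro m hm
  rcases Finset.mem_union.mp (support_add hm) with h | h
  exacts [hp m h, hq m h]

/-- Being a quotient of two polynomials in the same coset of `Λ`. -/
def TT (Λ : AddSubgroup (Fin N → ℤ)) (f : FractionRing (MvPolynomial (Fin N) k)) : Prop :=
  ∃ (p q : MvPolynomial (Fin N) k) (c : Fin N → ℤ), q ≠ 0 ∧ f = algebraMap _ _ p / algebraMap _ _ q ∧
    inCos Λ c p ∧ inCos Λ c q

lemma alg_ne (p : MvPolynomial (Fin N) k) (hp : p ≠ 0) : algebraMap (MvPolynomial (Fin N) k)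
    (FractionRing (MvPolynomial (Fin N) k)) p ≠ 0 := by
  intro h
  exact hp (IsFractionRing.injective (MvPolynomial (Fin N) k)
    (FractionRing (MvPolynomial (Fin N) k)) (by rw [h, map_zero]))

lemma TT_const (Λ : AddSubgroup (Fin N → ℤ)) (x : k) :
    TT Λ (algebraMap k (FractionRing (MvPolynomial (Fin N) k)) x) := by
  classical
  have h : ∀ x : k, inCos Λ 0 (C x : MvPolynomial (Fin N) k) := by
    intro x m hm
    rw [mem_support_iff, coeff_C] at hm
    have : 0 = m := by
      by_contra h
      exact hm (if_neg h)
    subst this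
    have : zv (0 : Fin N →₀ ℕ) - 0 = 0 := by ext i; simp [zv]
    rw [this]
    exact Λ.zero_mem
  refine ⟨C x, C 1, 0, by simp, ?_, h x, h 1⟩
  rw [map_one, map_one, div_one, ← algebraMap_eq, ← IsScalarTower.algebraMap_apply]

lemma TT_adjoin (Λ : AddSubgroup (Fin N → ℤ)) (S : Set (FractionRing (MvPolynomial (Fin N) k)))
    (hS : ∀ f ∈ S, TT Λ f) (f) (hf : f ∈ IntermediateField.adjoin k S) : TT Λ f := by
  induction hf using IntermediateField.adjoin_induction with
  | mem x hx => exact hS x hx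
  | algebraMap x => exact TT_const Λ x
  | add x y _ _ hx hy =>
    obtain ⟨p, q, c, hq, rfl, h1, h2⟩ := hx
    obtain ⟨p', q', c', hq', rfl, h1', h2'⟩ := hy
    refine ⟨p * q' + q * p', q * q', c + c', mul_ne_zero hq hq', ?_, ?_, ?_⟩
    · rw [div_add_div _ _ (alg_ne _ hq) (alg_ne _ hq')]
      simp only [map_add, map_mul]
    · exact inCos_add _ _ _ _ (inCos_mul _ _ _ _ _ h1 h2') (inCos_mul _ _ _ _ _ h2 h1')
    · exact inCos_mul _ _ _ _ _ h2 h2'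
  | inv x _ hx =>
    obtain ⟨p, q, c, hq, rfl, h1, h2⟩ := hx
    by_cases hp : p = 0
    · subst hp
      simpa using TT_const Λ (0 : k)
    · exact ⟨q, p, c, hp, by rw [inv_div], h2, h1⟩
  | mul x y _ _ hx hy =>
    obtain ⟨p, q, c, hq, rfl, h1, h2⟩ := hx
    obtain ⟨p', q', c', hq', rfl, h1', h2'⟩ := hy
    refine ⟨p * p', q * q', c + c', mul_ne_zero hq hq', ?_, ?_, ?_⟩
    · rw [div_mul_div_comm]
      simp only [map_mul]
    · exact inCos_mul _ _ _ _ _ h1 h1'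
    · exact inCos_mul _ _ _ _ _ h2 h2'

lemma TT_laur (Λ : AddSubgroup (Fin N → ℤ)) (b : Fin N → ℤ) (h : TT Λ (laur (k := k) b)) :
    b ∈ Λ := by
  obtain ⟨p, q, c, hq, e, h1, h2⟩ := h
  rw [laur_eq, div_eq_div_iff (alg_ne _ (by simp)) (alg_ne _ hq), ← map_mul, ← map_mul] at e
  have e := IsFractionRing.injective (MvPolynomial (Fin N) k)
    (FractionRing (MvPolynomial (Fin N) k)) e
  obtain ⟨m, hm⟩ := support_nonempty.mpr hq
  have e2 := congrArg (coeff (posP b + m)) e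
  rw [coeff_monomial_mul, one_mul, coeff_mul_monomial'] at e2
  have hm' := mem_support_iff.mp hm
  split_ifs at e2 with hle
  · rw [mul_one] at e2
    have h3 := h1 (posP b + m - posP (-b)) (mem_support_iff.mpr (e2 ▸ hm'))
    have h4 := h2 m hm
    have : b = (zv (posP b + m - posP (-b)) - c) - (zv m - c) := by
      have h5 : zv (posP b + m - posP (-b)) + zv (posP (-b)) = zv (posP b) + zv m := by
        rw [← zv_add, tsub_add_cancel_of_le hle, zv_add]
      have h6 := zv_posP_sub b
      rw [sub_sub_sub_cancel_right, eq_sub_of_add_eq h5, add_sub_right_comm,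
        add_sub_cancel_right, h6]
    rw [this]
    exact Λ.sub_mem h3 h4
  · exact absurd e2 hm'

lemma mem_of_cos (Λ : AddSubgroup (Fin N → ℤ)) (K : IntermediateField k
    (FractionRing (MvPolynomial (Fin N) k))) (hK : ∀ a ∈ Λ, laur a ∈ K)
    (c : Fin N → ℤ) (p : MvPolynomial (Fin N) k) (hp : inCos Λ c p) :
    algebraMap _ _ p / laur c ∈ K := by
  conv => arg 2; rw [p.as_sum]
  rw [map_sum, Finset.sum_div]
  refine K.sum_mem fun m hm => ?_
  have : algebraMap (MvPolynomial (Fin N) k) (FractionRing (MvPolynomial (Fin N) k))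
      (monomial m (coeff m p)) / laur c =
      algebraMap k (FractionRing (MvPolynomial (Fin N) k)) (coeff m p) * laur (zv m - c) := by
    rw [laur_sub, laur_zv, IsScalarTower.algebraMap_apply k (MvPolynomial (Fin N) k), algebraMap_eq,
      ← mul_div_assoc, ← map_mul, C_mul_monomial, mul_one]
  rw [this]
  exact K.mul_mem (K.algebraMap_mem _) (hK _ (hp m hm))

/-- For a diagonal action of a finite abelian group `G` (in nonmodular
characteristic) and a positive integer `d`, the points of `L(G,V)` of degree at most `d`
generate `L(G,V)` as a group if and only if the invariant rational functions of degree at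
most `d` generate the invariant field over `k`. -/
theorem stmt5 {k : Type} [Field k] {N : ℕ} {G : Type} [CommGroup G] [Fintype G]
    (hchar : (Fintype.card G : k) ≠ 0) (χ : Fin N → (G →* kˣ)) (d : ℕ) (hd : 0 < d) :
    AddSubgroup.closure {a : Fin N → ℤ | inLat χ a ∧ degZ a ≤ d} = latgrp χ ↔
      ∀ f, IsInv (diagρ χ) f →
        f ∈ IntermediateField.adjoin k {h | IsInv (diagρ χ) h ∧ RDegLE h d} := by
  constructor
  · intro hcl f hf
    obtain ⟨p, ⟨q, hq0⟩, hrel, hfe⟩ := IsFractionRing.exists_reduced_fraction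
      (MvPolynomial (Fin N) k) f
    have hq : q ≠ 0 := nonZeroDivisors.ne_zero hq0
    rw [IsFractionRing.mk'_eq_div] at hfe
    simp only at hfe hrel
    have hk := key χ f hf p q hq (fun r h1 h2 => hrel h1 h2) hfe.symm
    obtain ⟨n, hn⟩ := support_nonempty.mpr hq
    set K := IntermediateField.adjoin k {h | IsInv (diagρ χ) h ∧ RDegLE h d} with hKdef
    have hK : ∀ a ∈ latgrp χ, laur a ∈ K := by
      intro a ha
      rw [← hcl] at ha
      induction ha using AddSubgroup.closure_induction with
      | mem a ha =>
        exact IntermediateField.subset_adjoin _ _ ⟨laur_inv χ a ha.1, laur_deg a d ha.2⟩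
      | zero => simp [laur]
      | add a b _ _ iha ihb => rw [laur_add]; exact K.mul_mem iha ihb
      | neg a _ iha => rw [laur_neg]; exact K.inv_mem iha
    have h1 := mem_of_cos (latgrp χ) K hK (zv n) p (fun m hm => hk m n (.inl hm) (.inr hn))
    have h2 := mem_of_cos (latgrp χ) K hK (zv n) q (fun m hm => hk m n (.inr hm) (.inr hn))
    have h3 := K.div_mem h1 h2
    rw [div_div_div_cancel_right₀ (laur_ne _), hfe] at h3
    exact h3
  · intro H
    apply le_antisymm
    · rw [AddSubgroup.closure_le]
      exact fun a ha => ha.1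
    · intro b hb
      apply TT_laur (k := k)
      refine TT_adjoin _ _ ?_ _ (H _ (laur_inv χ b hb))
      rintro f ⟨hf, p, q, hq, hpq, hfe, hdeg⟩
      by_cases hp : p = 0
      · subst hp
        rw [hfe]
        simpa using TT_const (AddSubgroup.closure {a : Fin N → ℤ | inLat χ a ∧ degZ a ≤ d}) (0 : k)
      · have hk := key χ f hf p q hq hpq hfe
        obtain ⟨n, hn⟩ := support_nonempty.mpr hq
        obtain ⟨l, hl⟩ := support_nonempty.mpr hp
        have hmem : ∀ m ∈ p.support, ∀ n ∈ q.support, zv m - zv n ∈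
            AddSubgroup.closure {a : Fin N → ℤ | inLat χ a ∧ degZ a ≤ d} := fun m hm n hn =>
          AddSubgroup.subset_closure ⟨hk m n (.inl hm) (.inr hn),
            (degZ_sub_le m n p q hm hn).trans hdeg⟩
        refine ⟨p, q, zv n, hq, hfe, fun m hm => hmem m hm n hn, fun m hm => ?_⟩
        have := AddSubgroup.sub_mem _ (hmem l hl n hn) (hmem l hl m hm)
        rwa [sub_sub_sub_cancel_left] at this
end
end

section
/- Let G be a finite abelian group, k a field whose characteristic does not divide |G|, and V a faithful finite-dimensional representation of G over k. Let m be the number of distinct nontrivial characters χ : G → (k̄)ˣ whose eigenspace in the base change of V to an algebraic closure k̄ of k is nonzero. Then γ^r(G,V)^m ≥ |G|, i.e. γ^r(G,V) ≥ |G|^{1/m}. -/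
open MvPolynomial

noncomputable section

variable {k : Type} [Field k] {N : ℕ} {G : Type}

/-- The character `χ : G → Lˣ` occurs in the base change to `L` of the representation `ρ`,
i.e. its eigenspace in `L ⊗ V` is nonzero. -/
def Occurs {L : Type} [Field L] [Algebra k L] [Monoid G] (ρ : G → GL (Fin N) k)
    (χ : G →* Lˣ) : Prop :=
  ∃ v : Fin N → L, v ≠ 0 ∧
    ∀ g, ((ρ g : Matrix (Fin N) (Fin N) k).map (algebraMap k L)).mulVec v = (χ g : L) • v

section helper1
variable {F : Type} [Field F]

lemma mAct_diag_coeff (c : Fin N → F) (p : MvPolynomial (Fin N) F) (e : Fin N →₀ ℕ) :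
    coeff e (mAct (Matrix.diagonal c) p) = (∏ i, c i ^ e i) * coeff e p := by
  induction p using MvPolynomial.induction_on' with
  | add p q hp hq => simp [hp, hq, mul_add]
  | monomial u a =>
    have h1 : mAct (Matrix.diagonal c) (monomial u a) = monomial u ((∏ i, c i ^ u i) * a) := by
      rw [mAct, aeval_monomial]
      have : ∀ i, ∑ j, C (Matrix.diagonal c i j) * X j = (C (c i) * X i : MvPolynomial (Fin N) F) := by
        intro i
        rw [Finset.sum_eq_single i]
        · simp
        · intro j _ hj
          simp [Matrix.diagonal_apply_ne _ (Ne.symm hj)]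
        · simp
      simp only [this]
      rw [Finsupp.prod_fintype _ _ (by simp)]
      simp only [mul_pow, Finset.prod_mul_distrib]
      rw [monomial_eq, Finsupp.prod_fintype _ _ (by simp)]
      simp only [map_mul, map_prod, map_pow, algebraMap_eq]
      ring
    rw [h1, coeff_monomial, coeff_monomial]
    split_ifs with h
    · rw [h]
    · simp

lemma mAct_totalDegree_le (M : Matrix (Fin N) (Fin N) F) (p : MvPolynomial (Fin N) F) :
    (mAct M p).totalDegree ≤ p.totalDegree := by
  have hX : ∀ i, (∑ j, C (M i j) * X j : MvPolynomial (Fin N) F).totalDegree ≤ 1 := by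
    intro i
    refine totalDegree_finsetSum_le fun j _ => ?_
    refine (totalDegree_mul _ _).trans ?_
    simp
  rw [mAct, aeval_def, eval₂_eq]
  refine totalDegree_finsetSum_le fun d hd => ?_
  refine (totalDegree_mul _ _).trans ?_
  rw [algebraMap_eq, totalDegree_C, zero_add]
  refine (totalDegree_finsetProd _ _).trans ?_
  calc _ ≤ ∑ i ∈ d.support, d i := by
        refine Finset.sum_le_sum fun i _ => ?_
        refine (totalDegree_pow _ _).trans ?_
        exact (Nat.mul_le_mul_left _ (hX i)).trans (by simp)
    _ ≤ _ := le_totalDegree hd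

lemma semiinv {M : GL (Fin N) F} {p q : MvPolynomial (Fin N) F} (hp : p ≠ 0) (hq : q ≠ 0)
    (hpq : IsRelPrime p q)
    (h : fAct M (algebraMap _ (FractionRing (MvPolynomial (Fin N) F)) p / algebraMap _ _ q) =
      algebraMap _ (FractionRing (MvPolynomial (Fin N) F)) p / algebraMap _ _ q) :
    ∃ c : F, mAct (M : Matrix (Fin N) (Fin N) F) p = C c * p ∧
      mAct (M : Matrix (Fin N) (Fin N) F) q = C c * q := by
  have hinj := IsFractionRing.injective (MvPolynomial (Fin N) F) (FractionRing (MvPolynomial (Fin N) F))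
  have hfa : ∀ r, fAct M (algebraMap _ (FractionRing (MvPolynomial (Fin N) F)) r) =
      algebraMap _ _ (mAct (M : Matrix (Fin N) (Fin N) F) r) := by
    intro r
    rw [fAct, IsFractionRing.ringEquivOfRingEquiv_algebraMap]
    rfl
  have hinjm : Function.Injective (mAct (M : Matrix (Fin N) (Fin N) F)) := (mEquiv M).injective
  have hmp : mAct (M : Matrix (Fin N) (Fin N) F) p ≠ 0 := by
    rwa [ne_eq, map_eq_zero_iff _ hinjm]
  have hmq : mAct (M : Matrix (Fin N) (Fin N) F) q ≠ 0 := by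
    rwa [ne_eq, map_eq_zero_iff _ hinjm]
  rw [map_div₀, hfa, hfa, div_eq_div_iff, ← map_mul, ← map_mul] at h
  rotate_left
  · rwa [ne_eq, map_eq_zero_iff _ hinj]
  · rwa [ne_eq, map_eq_zero_iff _ hinj]
  replace h := hinj h
  obtain ⟨r, hr⟩ : p ∣ mAct (M : Matrix (Fin N) (Fin N) F) p :=
    hpq.dvd_of_dvd_mul_right ⟨_, h⟩
  have hr0 : r ≠ 0 := by rintro rfl; simp at hr; exact hp ((map_eq_zero_iff _ hinjm).1 hr)
  have hd := mAct_totalDegree_le (M : Matrix (Fin N) (Fin N) F) p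
  rw [hr, totalDegree_mul_of_isDomain hp hr0] at hd
  have : r.totalDegree = 0 := by omega
  rw [totalDegree_eq_zero_iff_eq_C] at this
  refine ⟨coeff 0 r, ?_, ?_⟩
  · rw [← this, hr, mul_comm]
  · rw [← this]
    rw [hr, mul_assoc] at h
    exact (mul_left_cancel₀ hp h).symm

end helper1
section helper2
variable {J : Type} [Fintype J] [DecidableEq J]

lemma natAbs_det_le (A : Matrix J J ℤ) (d : ℕ) (hA : ∀ i, ∑ j, (A i j).natAbs ≤ d) :
    A.det.natAbs ≤ d ^ Fintype.card J := by
  rw [Matrix.det_apply]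
  calc _ ≤ ∑ σ : Equiv.Perm J, ∏ i, (A i (σ i)).natAbs := by
        rw [← Equiv.sum_comp (Equiv.inv (Equiv.Perm J))]
        refine (Int.natAbs_sum_le _ _).trans (Finset.sum_le_sum fun σ _ => ?_)
        rw [Units.smul_def, smul_eq_mul, Int.natAbs_mul, Int.units_natAbs, one_mul]
        rw [← Int.natAbsHom_apply, map_prod]
        rw [← Equiv.prod_comp σ]
        simp
    _ ≤ ∑ f : J → J, ∏ i, (A i (f i)).natAbs := by
        rw [← Finset.sum_image (s := Finset.univ) (g := fun σ : Equiv.Perm J => (σ : J → J))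
          (f := fun f : J → J => ∏ i, (A i (f i)).natAbs)]
        · exact Finset.sum_le_sum_of_subset (Finset.subset_univ _)
        · intro a _ b _ h
          exact Equiv.coe_fn_injective h
    _ = ∏ i, ∑ j, (A i j).natAbs := by
        rw [Finset.prod_univ_sum]; simp
    _ ≤ _ := by
        refine (Finset.prod_le_pow_card _ _ d (fun i _ => hA i)).trans ?_
        simp

lemma index_le_det (A : Matrix J J ℤ) (hA : A.det ≠ 0) (Λ : AddSubgroup (J → ℤ))
    (h : ∀ i, A i ∈ Λ) : Λ.index ≤ A.det.natAbs := by
  have hli : LinearIndependent ℤ A.row := Matrix.linearIndependent_rows_of_det_ne_zero hA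
  let b := Module.Basis.span hli
  let S : AddSubgroup (J → ℤ) := (Submodule.span ℤ (Set.range A.row)).toAddSubgroup
  have hS : S ≤ Λ := by
    have : Submodule.span ℤ (Set.range A.row) ≤ Λ.toIntSubmodule := by
      rw [Submodule.span_le]
      rintro _ ⟨i, rfl⟩
      exact h i
    exact this
  have hidx := AddSubgroup.index_eq_natAbs_det (Pi.basisFun ℤ J) S b
  have hb : (fun i => ((b i : Submodule.span ℤ (Set.range A.row)) : J → ℤ)) = A := by
    funext i
    exact congrArg _ (Module.Basis.span_apply hli i)
  have hdet : (Pi.basisFun ℤ J).det (fun i => ((b i : Submodule.span ℤ (Set.range A.row)) : J → ℤ)) = A.det := by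
    rw [hb, Pi.basisFun_det]
    rfl
  have hidx' : S.index = A.det.natAbs := by
    rw [hidx]; congr 1
  rw [← hidx']
  refine Nat.le_of_dvd ?_ (AddSubgroup.index_dvd_of_le hS)
  rw [hidx']
  exact Int.natAbs_pos.2 hA

lemma lattice_alt (Λ : AddSubgroup (J → ℤ)) (d : ℕ) (hlt : d ^ Fintype.card J < Λ.index) :
    ∃ w : J → ℤ, w ≠ 0 ∧ ∀ e ∈ Λ, ∑ j, (e j).natAbs ≤ d → ∑ j, w j * e j = 0 := by
  let cst : (J → ℤ) → (J → ℚ) := fun e j => (e j : ℚ)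
  let S : Set (J → ℤ) := {e | e ∈ Λ ∧ ∑ j, (e j).natAbs ≤ d}
  have hspan : Submodule.span ℚ (cst '' S) < ⊤ := by
    rw [lt_top_iff_ne_top]
    intro htop
    obtain ⟨b, hb, hsp, hli⟩ := exists_linearIndependent ℚ (cst '' S)
    rw [htop] at hsp
    let B := Module.Basis.mk hli (by rw [Subtype.range_coe, hsp])
    let ι : b ≃ J := B.indexEquiv (Pi.basisFun ℚ J)
    have hch : ∀ x : b, ∃ e ∈ S, cst e = x := fun x => hb x.2
    choose v hvS hv using hch
    let A : Matrix J J ℤ := fun i => v (ι.symm i)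
    have hdet : A.det ≠ 0 := by
      have hmap : (A.map (Int.castRingHom ℚ)).det ≠ 0 := by
        rw [← isUnit_iff_ne_zero, ← Matrix.isUnit_iff_isUnit_det, ← Matrix.linearIndependent_rows_iff_isUnit]
        have h2 : LinearIndependent ℚ ((Subtype.val : b → (J → ℚ)) ∘ ι.symm) :=
          hli.comp _ ι.symm.injective
        have h3 : (A.map (Int.castRingHom ℚ)).row = (Subtype.val : b → (J → ℚ)) ∘ ι.symm := by
          funext i
          exact hv (ι.symm i)
        rw [h3]
        exact h2
      intro h0
      apply hmap
      rw [← RingHom.mapMatrix_apply, ← RingHom.map_det, h0, map_zero]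
    have h1 := index_le_det A hdet Λ (fun i => (hvS _).1)
    have h2 := natAbs_det_le A d (fun i => (hvS _).2)
    omega
  obtain ⟨f, hf0, hf⟩ := Submodule.exists_le_ker_of_lt_top _ hspan
  obtain ⟨n, hn⟩ := IsLocalization.exist_integer_multiples_of_finite (nonZeroDivisors ℤ)
    (fun j : J => f (Pi.single j 1))
  choose w hw using hn
  have hn0 : ((n : ℤ) : ℚ) ≠ 0 := by
    exact_mod_cast nonZeroDivisors.ne_zero n.2
  have hw' : ∀ j, (w j : ℚ) = (n : ℤ) * f (Pi.single j 1) := by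
    intro j
    have := hw j
    simpa [Algebra.smul_def] using this
  have hfe : ∀ e : J → ℚ, f e = ∑ j, e j * f (Pi.single j 1) := by
    intro e
    rw [LinearMap.pi_apply_eq_sum_univ f e]
    refine Finset.sum_congr rfl fun j _ => ?_
    rw [smul_eq_mul]
    congr 2
    funext i
    simp [Pi.single_apply, eq_comm]
  refine ⟨w, ?_, ?_⟩
  · rintro rfl
    apply hf0
    ext j
    have := hw' j
    simp [hn0] at this
    simp [this]
  · intro e he hed
    have h0 : f (cst e) = 0 := hf (Submodule.subset_span ⟨e, ⟨he, hed⟩, rfl⟩)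
    have : ((∑ j, w j * e j : ℤ) : ℚ) = 0 := by
      push_cast
      simp only [hw']
      rw [hfe] at h0
      calc _ = ((n : ℤ) : ℚ) * ∑ j, cst e j * f (Pi.single j 1) := by
            rw [Finset.mul_sum]
            exact Finset.sum_congr rfl fun j _ => by simp only [cst]; ring
        _ = 0 := by rw [h0, mul_zero]
    exact_mod_cast this

end helper2
section helper3
variable {L : Type} [Field L]

lemma sum_chars [CommGroup G] [Fintype G] [Fintype (G →* Lˣ)]
    [HasEnoughRootsOfUnity L (Monoid.exponent G)] {g : G} (hg : g ≠ 1) :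
    ∑ χ : G →* Lˣ, (χ g : L) = 0 := by
  obtain ⟨φ, hφ⟩ := CommGroup.exists_apply_ne_one_of_hasEnoughRootsOfUnity G L hg
  have h : (φ g : L) * ∑ χ : G →* Lˣ, (χ g : L) = ∑ χ : G →* Lˣ, (χ g : L) := by
    rw [Finset.mul_sum]
    exact Equiv.sum_comp (Equiv.mulLeft φ) (fun χ : G →* Lˣ => (χ g : L))
  have h1 : (φ g : L) ≠ 1 := by
    intro h; exact hφ (Units.ext h)
  have : ((φ g : L) - 1) * ∑ χ : G →* Lˣ, (χ g : L) = 0 := by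
    rw [sub_mul, h]; ring
  rcases mul_eq_zero.1 this with h2 | h2
  · exact absurd (sub_eq_zero.1 h2) h1
  · exact h2

lemma eigen_basis [CommGroup G] [Fintype G]
    [HasEnoughRootsOfUnity L (Monoid.exponent G)] (hc : (Fintype.card G : L) ≠ 0)
    (R : G →* Matrix (Fin N) (Fin N) L) :
    ∃ (P : GL (Fin N) L) (χ : Fin N → (G →* Lˣ)), ∀ g,
      R g * (P : Matrix (Fin N) (Fin N) L) =
        (P : Matrix (Fin N) (Fin N) L) * Matrix.diagonal (fun i => (χ i g : L)) := by
  classical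
  have e := (CommGroup.monoidHom_mulEquiv_of_hasEnoughRootsOfUnity G L).some
  let : Fintype (G →* Lˣ) := Fintype.ofEquiv G e.symm.toEquiv
  have hcard : Fintype.card (G →* Lˣ) = Fintype.card G := Fintype.card_congr e.toEquiv
  let E : Set (Fin N → L) := {v | ∃ χ : G →* Lˣ, ∀ g, (R g).mulVec v = (χ g : L) • v}
  have hE : Submodule.span L E = ⊤ := by
    rw [eq_top_iff]
    intro v _
    let π : (G →* Lˣ) → (Fin N → L) := fun χ => ∑ g, (χ g⁻¹ : L) • (R g).mulVec v
    have hπ : ∀ χ, π χ ∈ E := by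
      intro χ
      refine ⟨χ, fun h => ?_⟩
      simp only [π]
      rw [Matrix.mulVec_sum, Finset.smul_sum, ← Equiv.sum_comp (Equiv.mulLeft h⁻¹)]
      refine Finset.sum_congr rfl fun g _ => ?_
      rw [Matrix.mulVec_smul, Matrix.mulVec_mulVec, ← map_mul, smul_smul]
      simp [mul_comm]
    have hsum : ∑ χ, π χ = (Fintype.card G : L) • v := by
      simp only [π]
      rw [Finset.sum_comm, Finset.sum_eq_single 1]
      · rw [Nat.cast_smul_eq_nsmul, ← hcard]
        simp only [inv_one, map_one, Units.val_one, one_smul, Matrix.one_mulVec,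
          Finset.sum_const, Finset.card_univ]
      · intro g _ hg
        rw [← Finset.sum_smul, sum_chars (inv_ne_one.2 hg), zero_smul]
      · simp
    have : v = (Fintype.card G : L)⁻¹ • ∑ χ, π χ := by
      rw [hsum, smul_smul, inv_mul_cancel₀ hc, one_smul]
    rw [this]
    exact Submodule.smul_mem _ _ (Submodule.sum_mem _ fun χ _ => Submodule.subset_span (hπ χ))
  obtain ⟨b, hb, hsp, hli⟩ := exists_linearIndependent L E
  rw [hE] at hsp
  let B := Module.Basis.mk hli (by rw [Subtype.range_coe, hsp])
  let ι : b ≃ Fin N := B.indexEquiv (Pi.basisFun L (Fin N))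
  have hch : ∀ x : b, ∃ χ : G →* Lˣ, ∀ g, (R g).mulVec x = (χ g : L) • x.1 := fun x => hb x.2
  choose χ hχ using hch
  let A : Matrix (Fin N) (Fin N) L := Matrix.of fun i j => (ι.symm j).1 i
  have hA : IsUnit A := by
    rw [← Matrix.linearIndependent_cols_iff_isUnit]
    exact hli.comp _ ι.symm.injective
  refine ⟨hA.unit, fun i => χ (ι.symm i), fun g => ?_⟩
  rw [IsUnit.unit_spec]
  ext i j
  rw [Matrix.mul_diagonal]
  have := congrFun (hχ (ι.symm j) g) i
  simp only [Pi.smul_apply, smul_eq_mul] at this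
  exact this.trans (mul_comm _ _)

/-- the index of the relation lattice -/
lemma card_le_index [CommGroup G] [Fintype G]
    [HasEnoughRootsOfUnity L (Monoid.exponent G)]
    {J : Type} [Fintype J] (χ : J → (G →* Lˣ)) (hsep : ∀ g, (∀ j, χ j g = 1) → g = 1)
    (Λ : AddSubgroup (J → ℤ)) (hΛ : ∀ e, e ∈ Λ ↔ ∀ g, ∏ j, χ j g ^ e j = 1) :
    Fintype.card G ≤ Λ.index := by
  classical
  have em := (CommGroup.monoidHom_mulEquiv_of_hasEnoughRootsOfUnity G L).some
  have : Finite (G →* Lˣ) := Finite.of_equiv G em.symm.toEquiv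
  let Θ : Multiplicative (J → ℤ) →* (G →* Lˣ) :=
    { toFun := fun e =>
        { toFun := fun g => ∏ j, χ j g ^ (e.toAdd j)
          map_one' := by simp
          map_mul' := by intro a b; simp [mul_zpow, Finset.prod_mul_distrib] }
      map_one' := by ext g; simp
      map_mul' := by intro a b; ext g; simp [zpow_add, Finset.prod_mul_distrib] }
  have hidx : Λ.index = Θ.ker.index := by
    have : Θ.ker = AddSubgroup.toSubgroup Λ := by
      ext e
      rw [MonoidHom.mem_ker]
      exact (DFunLike.ext_iff (f := Θ e) (g := 1)).trans (hΛ e.toAdd).symm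
    rw [this]
    exact (AddSubgroup.index_toSubgroup (H := Λ)).symm
  rw [hidx, Subgroup.index_ker]
  have : HasEnoughRootsOfUnity L (Monoid.exponent Θ.range) := by
    refine HasEnoughRootsOfUnity.of_dvd L (n := Monoid.exponent G) ?_
    refine (Monoid.exponent_submonoid_dvd Θ.range.toSubmonoid).trans ?_
    rw [Monoid.exponent_eq_of_mulEquiv em]
  rw [← CommGroup.card_monoidHom_of_hasEnoughRootsOfUnity Θ.range L, ← Nat.card_eq_fintype_card]
  have em2 := (CommGroup.monoidHom_mulEquiv_of_hasEnoughRootsOfUnity Θ.range L).some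
  have : Finite (Θ.range →* Lˣ) := Finite.of_equiv Θ.range em2.symm.toEquiv
  let ev : G → (Θ.range →* Lˣ) := fun g =>
    { toFun := fun φ => φ.1 g, map_one' := rfl, map_mul' := fun _ _ => rfl }
  refine Nat.card_le_card_of_injective ev ?_
  intro g h hgh
  have : g * h⁻¹ = 1 := by
    apply hsep
    intro j
    have hj : χ j ∈ Θ.range := ⟨Multiplicative.ofAdd (Pi.single j 1), by
      refine MonoidHom.ext fun x => ?_
      change ∏ i, χ i x ^ ((Pi.single j 1 : J → ℤ) i) = χ j x
      rw [Finset.prod_eq_single j]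
      · simp
      · intro i _ hi; simp [Pi.single_eq_of_ne hi]
      · simp⟩
    have := DFunLike.congr_fun hgh ⟨χ j, hj⟩
    change χ j g = χ j h at this
    rw [map_mul, map_inv, this, mul_inv_cancel]
  exact mul_inv_eq_one.1 this

end helper3
section helper4

/-- The orbit polynomial of a coordinate. -/
def orbP {F : Type} [Field F] [Fintype G] (ρ : G → GL (Fin N) F) (i : Fin N) :
    Polynomial (FractionRing (MvPolynomial (Fin N) F)) :=
  ∏ g, (Polynomial.X - Polynomial.C (algebraMap (MvPolynomial (Fin N) F)
    (FractionRing (MvPolynomial (Fin N) F)) (mAct (ρ g : Matrix (Fin N) (Fin N) F) (X i))))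

lemma fAct_algebraMap {F : Type} [Field F] (M : GL (Fin N) F) (r : MvPolynomial (Fin N) F) :
    fAct M (algebraMap _ (FractionRing (MvPolynomial (Fin N) F)) r) =
      algebraMap _ _ (mAct (M : Matrix (Fin N) (Fin N) F) r) := by
  rw [fAct, IsFractionRing.ringEquivOfRingEquiv_algebraMap]
  rfl

variable {F : Type} [Field F] [CommGroup G] [Fintype G] (ρ : G →* GL (Fin N) F)

lemma orbP_inv (i : Fin N) (n : ℕ) : IsInv (fun g => ρ g) ((orbP (fun g => ρ g) i).coeff n) := by
  intro h
  have key : (orbP (fun g => ρ g) i).map (fAct (ρ h)).toRingHom = orbP (fun g => ρ g) i := by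
    rw [orbP, Polynomial.map_prod]
    refine Eq.trans ?_ (Equiv.prod_comp (Equiv.mulRight h) _)
    refine Finset.prod_congr rfl fun g _ => ?_
    rw [Polynomial.map_sub, Polynomial.map_X, Polynomial.map_C]
    congr 2
    change fAct (ρ h) _ = _
    rw [fAct_algebraMap, ← AlgHom.comp_apply, mAct_comp]
    simp
  have := congrArg (fun p => Polynomial.coeff p n) key
  simp only [Polynomial.coeff_map] at this
  exact this

lemma orbP_alg (i : Fin N) (S : Type) [CommRing S]
    [Algebra S (FractionRing (MvPolynomial (Fin N) F))]
    (hS : ∀ n, (orbP (fun g => ρ g) i).coeff n ∈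
      Set.range (algebraMap S (FractionRing (MvPolynomial (Fin N) F)))) :
    IsAlgebraic S (algebraMap (MvPolynomial (Fin N) F)
      (FractionRing (MvPolynomial (Fin N) F)) (X i)) := by
  have h1 : orbP (fun g => ρ g) i ∈ Polynomial.lifts (algebraMap S (FractionRing (MvPolynomial (Fin N) F))) := by
    rw [Polynomial.lifts_iff_coeff_lifts]
    exact hS
  obtain ⟨q, hq⟩ := (Polynomial.mem_lifts _).1 h1
  have hmon : (orbP (fun g => ρ g) i).Monic :=
    Polynomial.monic_prod_of_monic _ _ fun g _ => Polynomial.monic_X_sub_C _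
  refine ⟨q, ?_, ?_⟩
  · rintro rfl
    rw [Polynomial.map_zero] at hq
    exact hmon.ne_zero hq.symm
  · rw [Polynomial.aeval_def, ← Polynomial.eval_map, hq, orbP, Polynomial.eval_prod]
    refine Finset.prod_eq_zero (Finset.mem_univ 1) ?_
    simp [mAct_one]

lemma all_alg (S : Subalgebra F (FractionRing (MvPolynomial (Fin N) F)))
    (hS : ∀ i, IsAlgebraic S (algebraMap (MvPolynomial (Fin N) F)
      (FractionRing (MvPolynomial (Fin N) F)) (X i))) :
    Algebra.IsAlgebraic S (FractionRing (MvPolynomial (Fin N) F)) := by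
  have hp : ∀ p : MvPolynomial (Fin N) F, IsAlgebraic S (algebraMap (MvPolynomial (Fin N) F)
      (FractionRing (MvPolynomial (Fin N) F)) p) := by
    intro p
    induction p using MvPolynomial.induction_on with
    | C a =>
      have : algebraMap (MvPolynomial (Fin N) F) (FractionRing (MvPolynomial (Fin N) F)) (C a) =
          algebraMap S _ (algebraMap F S a) := by
        rw [← IsScalarTower.algebraMap_apply, ← algebraMap_eq, ← IsScalarTower.algebraMap_apply]
      rw [this]
      exact isAlgebraic_algebraMap _
    | add p q hp hq => rw [map_add]; exact hp.add hq
    | mul_X p i hp => rw [map_mul]; exact hp.mul (hS i)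
  refine ⟨fun x => ?_⟩
  obtain ⟨a, b, hb, rfl⟩ := IsFractionRing.div_surjective (A := MvPolynomial (Fin N) F) x
  rw [div_eq_mul_inv]
  exact (hp a).mul (hp b).inv

lemma RDegLE_exists (f : FractionRing (MvPolynomial (Fin N) F)) : ∃ d, RDegLE f d := by
  obtain ⟨a, b, hab, h⟩ := IsFractionRing.exists_reduced_fraction (MvPolynomial (Fin N) F) f
  refine ⟨_, a, b, nonZeroDivisors.ne_zero b.2, fun p h1 h2 => hab h1 h2, ?_, le_rfl⟩
  rw [← h, IsFractionRing.mk'_eq_div]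

lemma gamma_nonempty : ∃ d : ℕ, ∃ s : Set (FractionRing (MvPolynomial (Fin N) F)),
    (∀ f ∈ s, IsInv (fun g => ρ g) f ∧ RDegLE f d) ∧
    AlgebraicIndependent F ((↑) : s → FractionRing (MvPolynomial (Fin N) F)) ∧
    ∀ f, IsInv (fun g => ρ g) f → IsAlgebraic (IntermediateField.adjoin F s) f := by
  classical
  let t : Finset (FractionRing (MvPolynomial (Fin N) F)) :=
    Finset.univ.biUnion fun i : Fin N => (orbP (fun g => ρ g) i).coeffs
  have htI : ∀ f ∈ t, IsInv (fun g => ρ g) f := by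
    intro f hf
    simp only [t, Finset.mem_biUnion] at hf
    obtain ⟨i, _, hf⟩ := hf
    obtain ⟨n, _, rfl⟩ := Polynomial.mem_coeffs_iff.1 hf
    exact orbP_inv ρ i n
  have : Algebra.IsAlgebraic (Algebra.adjoin F (t : Set (FractionRing (MvPolynomial (Fin N) F))))
      (FractionRing (MvPolynomial (Fin N) F)) := by
    refine all_alg _ fun i => orbP_alg ρ i _ fun n => ?_
    by_cases h0 : (orbP (fun g => ρ g) i).coeff n = 0
    · rw [h0]; exact ⟨0, map_zero _⟩
    · refine ⟨⟨_, Algebra.subset_adjoin ?_⟩, rfl⟩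
      simp only [t, Finset.coe_biUnion, Set.mem_iUnion]
      exact ⟨i, by simp, Polynomial.coeff_mem_coeffs h0⟩
  obtain ⟨s, hst, hs⟩ := exists_isTranscendenceBasis_subset (R := F)
    (t : Set (FractionRing (MvPolynomial (Fin N) F)))
  choose dg hdg using RDegLE_exists (F := F) (N := N)
  refine ⟨t.sup dg, s, fun f hf => ⟨htI f (hst hf), ?_⟩, hs.1, fun f _ => ?_⟩
  · obtain ⟨a, b, h1, h2, h3, h4⟩ := hdg f
    exact ⟨a, b, h1, h2, h3, h4.trans (Finset.le_sup (f := dg) (hst hf))⟩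
  · have := hs.isAlgebraic_field
    rw [Subtype.range_coe] at this
    exact this.isAlgebraic f

lemma X_alg (s : Set (FractionRing (MvPolynomial (Fin N) F)))
    (hs : ∀ f, IsInv (fun g => ρ g) f → IsAlgebraic (IntermediateField.adjoin F s) f) (i : Fin N) :
    IsAlgebraic (IntermediateField.adjoin F s) (algebraMap (MvPolynomial (Fin N) F)
      (FractionRing (MvPolynomial (Fin N) F)) (X i)) := by
  have h := orbP_alg ρ i (algebraicClosure (IntermediateField.adjoin F s)
    (FractionRing (MvPolynomial (Fin N) F))) fun n => ⟨⟨_, ?_⟩, rfl⟩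
  · exact IsAlgebraic.restrictScalars _ h
  · rw [mem_algebraicClosure_iff]
    exact hs _ (orbP_inv ρ i n)

end helper4
section helper5

lemma zpow_sum_aux {H ι : Type} [CommGroup H] (t : H) (s : Finset ι) (f : ι → ℤ) :
    t ^ (∑ i ∈ s, f i) = ∏ i ∈ s, t ^ f i := by
  classical
  induction s using Finset.induction_on with
  | empty => simp
  | insert a s ha ih => rw [Finset.sum_insert ha, Finset.prod_insert ha, zpow_add, ih]

lemma finite_images {K A : Type} [Field K] [Field A] {F : Type} [Field F] [Algebra F K]
    {T : Type} (Φ : T → (K →+* A)) (s : Set K) (x : K)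
    (hF : ∀ a t t', Φ t (algebraMap F K a) = Φ t' (algebraMap F K a))
    (hs : ∀ f ∈ s, ∀ t t', Φ t f = Φ t' f)
    (hx : IsAlgebraic (IntermediateField.adjoin F s) x) :
    (Set.range fun t => Φ t x).Finite := by
  rcases isEmpty_or_nonempty T with hT | ⟨⟨t₀⟩⟩
  · rw [Set.range_eq_empty]; exact Set.finite_empty
  have hE : ∀ e ∈ IntermediateField.adjoin F s, ∀ t, Φ t e = Φ t₀ e := by
    intro e he t
    induction he using IntermediateField.adjoin_induction with
    | mem f hf => exact hs f hf _ _
    | algebraMap a => exact hF _ _ _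
    | add a b _ _ ha hb => rw [map_add, map_add, ha, hb]
    | inv a _ ha => rw [map_inv₀, map_inv₀, ha]
    | mul a b _ _ ha hb => rw [map_mul, map_mul, ha, hb]
  obtain ⟨p, hp0, hp⟩ := hx
  let ψ : IntermediateField.adjoin F s →+* A := (Φ t₀).comp (algebraMap _ K)
  have hq0 : p.map ψ ≠ 0 := (Polynomial.map_ne_zero_iff ψ.injective).2 hp0
  classical
  refine ((p.map ψ).roots.toFinset.finite_toSet).subset ?_
  rintro _ ⟨t, rfl⟩
  simp only [Finset.mem_coe, Multiset.mem_toFinset]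
  rw [Polynomial.mem_roots hq0, Polynomial.IsRoot.def, Polynomial.eval_map]
  have hψ : ψ = (Φ t).comp (algebraMap _ K) := by
    ext e
    exact (hE e.1 e.2 t).symm
  rw [hψ, ← Polynomial.hom_eval₂, ← Polynomial.aeval_def, hp, map_zero]

variable {L : Type} [Field L] [Algebra k L]

/-- Base change followed by an invertible linear substitution. -/
def phi (Q : GL (Fin N) L) : MvPolynomial (Fin N) k →+* MvPolynomial (Fin N) L :=
  (mAct (Q : Matrix (Fin N) (Fin N) L)).toRingHom.comp (MvPolynomial.map (algebraMap k L))

lemma phi_apply (Q : GL (Fin N) L) (p : MvPolynomial (Fin N) k) :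
    phi Q p = mAct (Q : Matrix (Fin N) (Fin N) L) (MvPolynomial.map (algebraMap k L) p) := rfl

lemma phi_inj (Q : GL (Fin N) L) :
    Function.Injective (phi Q : MvPolynomial (Fin N) k →+* MvPolynomial (Fin N) L) :=
  (mEquiv Q).injective.comp (MvPolynomial.map_injective _ (algebraMap k L).injective)

/-- Extension of `phi` to fraction fields. -/
def Phi (Q : GL (Fin N) L) :
    FractionRing (MvPolynomial (Fin N) k) →+* FractionRing (MvPolynomial (Fin N) L) :=
  IsFractionRing.map (phi_inj (k := k) Q)

lemma Phi_algebraMap (Q : GL (Fin N) L) (p : MvPolynomial (Fin N) k) :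
    Phi Q (algebraMap _ (FractionRing (MvPolynomial (Fin N) k)) p) =
      algebraMap _ (FractionRing (MvPolynomial (Fin N) L)) (phi Q p) := by
  rw [Phi, IsFractionRing.map, IsLocalization.map_eq]

lemma map_mAct (M : Matrix (Fin N) (Fin N) k) (p : MvPolynomial (Fin N) k) :
    MvPolynomial.map (algebraMap k L) (mAct M p) =
      mAct (M.map (algebraMap k L)) (MvPolynomial.map (algebraMap k L) p) := by
  induction p using MvPolynomial.induction_on with
  | C a => simp [mAct]
  | add p q hp hq => simp [hp, hq]
  | mul_X p i hp =>
    rw [map_mul, map_mul, map_mul, map_mul, hp]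
    congr 1
    simp [mAct]

/-- The diagonal one-parameter subgroup. -/
def dg (W : Fin N → ℤ) (t : Lˣ) : GL (Fin N) L where
  val := Matrix.diagonal fun i => ((t ^ W i : Lˣ) : L)
  inv := Matrix.diagonal fun i => (((t ^ W i)⁻¹ : Lˣ) : L)
  val_inv := by
    rw [Matrix.diagonal_mul_diagonal, ← Matrix.diagonal_one]
    exact congrArg _ (funext fun i => Units.mul_inv _)
  inv_val := by
    rw [Matrix.diagonal_mul_diagonal, ← Matrix.diagonal_one]
    exact congrArg _ (funext fun i => Units.inv_mul _)

lemma support_weight {G : Type} [CommGroup G] (ρ : G →* GL (Fin N) k) (P : GL (Fin N) L)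
    (χ : Fin N → (G →* Lˣ))
    (hP : ∀ g, ((ρ g : Matrix (Fin N) (Fin N) k).map (algebraMap k L)) *
        (P : Matrix (Fin N) (Fin N) L) =
        (P : Matrix (Fin N) (Fin N) L) * Matrix.diagonal (fun i => (χ i g : L)))
    (p : MvPolynomial (Fin N) k) (g : G) (c : k)
    (hc : mAct (ρ g : Matrix (Fin N) (Fin N) k) p = C c * p) (a : Fin N →₀ ℕ)
    (ha : coeff a (phi P p) ≠ 0) : ((∏ i, χ i g ^ a i : Lˣ) : L) = algebraMap k L c := by
  have h1 : mAct (Matrix.diagonal (fun i => (χ i g : L))) (phi P p) =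
      C (algebraMap k L c) * phi P p := by
    rw [phi_apply, ← AlgHom.comp_apply, mAct_comp, ← hP, ← mAct_comp, AlgHom.comp_apply,
      ← map_mAct, hc, map_mul, map_mul, map_C]
    congr 1
    simp [mAct]
  have h2 := congrArg (coeff a) h1
  rw [mAct_diag_coeff, coeff_C_mul] at h2
  have := mul_right_cancel₀ ha h2
  rw [← this]
  simp

lemma phi_totalDegree (P : GL (Fin N) L) (p : MvPolynomial (Fin N) k) (a : Fin N →₀ ℕ)
    (ha : coeff a (phi P p) ≠ 0) : ∑ i, a i ≤ p.totalDegree := by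
  have h1 := le_totalDegree (mem_support_iff.2 ha)
  rw [Finsupp.sum_fintype _ _ (by simp)] at h1
  refine h1.trans ?_
  rw [phi_apply]
  exact (mAct_totalDegree_le _ _).trans (Finset.sup_mono (support_map_subset _ _))

lemma scale_eq (W : Fin N → ℤ) (t : Lˣ) (p : MvPolynomial (Fin N) L) (h : ℤ)
    (hp : ∀ a, coeff a p ≠ 0 → ∑ i, W i * (a i : ℤ) = h) :
    mAct (dg W t : Matrix (Fin N) (Fin N) L) p = C ((t ^ h : Lˣ) : L) * p := by
  ext a
  change coeff a (mAct (Matrix.diagonal fun i => ((t ^ W i : Lˣ) : L)) p) = _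
  rw [mAct_diag_coeff, coeff_C_mul]
  by_cases h0 : coeff a p = 0
  · simp [h0]
  · congr 1
    rw [← hp a h0]
    have : t ^ (∑ i, W i * (a i : ℤ)) = ∏ i, (t ^ W i) ^ a i := by
      rw [zpow_sum_aux]
      exact Finset.prod_congr rfl fun i _ => by rw [zpow_mul, zpow_natCast]
    rw [this]
    simp

end helper5
section helper6
variable {L : Type} [Field L] [Algebra k L]

lemma core [IsAlgClosed L] {G : Type} [CommGroup G] (ρ : G →* GL (Fin N) k) (P : GL (Fin N) L)
    (χ : Fin N → (G →* Lˣ))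
    (hP : ∀ g, ((ρ g : Matrix (Fin N) (Fin N) k).map (algebraMap k L)) *
        (P : Matrix (Fin N) (Fin N) L) =
        (P : Matrix (Fin N) (Fin N) L) * Matrix.diagonal (fun i => (χ i g : L)))
    {J : Type} [Fintype J] (val : J → (G →* Lˣ)) (hinj : Function.Injective val)
    (hcov : ∀ i, χ i = 1 ∨ ∃ j, χ i = val j) (hsur : ∀ j, ∃ i, χ i = val j)
    (d : ℕ) (s : Set (FractionRing (MvPolynomial (Fin N) k)))
    (hs : ∀ f ∈ s, IsInv (fun g => ρ g) f ∧ RDegLE f d)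
    (halg : ∀ i, IsAlgebraic (IntermediateField.adjoin k s) (algebraMap (MvPolynomial (Fin N) k)
      (FractionRing (MvPolynomial (Fin N) k)) (X i)))
    (w : J → ℤ) (hw0 : w ≠ 0)
    (hw : ∀ e : J → ℤ, (∀ g, ∏ j, val j g ^ e j = 1) → ∑ j, (e j).natAbs ≤ d →
      ∑ j, w j * e j = 0) : False := by
  classical
  let W : Fin N → ℤ := fun i => ∑ j, if χ i = val j then w j else 0
  have hWj : ∀ i j, χ i = val j → W i = w j := by
    intro i j h
    simp only [W]
    rw [Finset.sum_eq_single j]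
    · simp [h]
    · intro j' _ hj'
      rw [if_neg]
      intro h'
      exact hj' (hinj (h'.symm.trans h))
    · simp
  -- exponents of numerator and denominator have equal weight
  have hwt : ∀ p q : MvPolynomial (Fin N) k, p.totalDegree + q.totalDegree ≤ d →
      (∀ g, ∃ c : k, mAct (ρ g : Matrix (Fin N) (Fin N) k) p = C c * p ∧
        mAct (ρ g : Matrix (Fin N) (Fin N) k) q = C c * q) →
      ∀ a b, coeff a (phi P p) ≠ 0 → coeff b (phi P q) ≠ 0 →
        ∑ i, W i * (a i : ℤ) = ∑ i, W i * (b i : ℤ) := by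
    intro p q hd hsemi a b ha hb
    let e : J → ℤ := fun j => ∑ i, if χ i = val j then ((a i : ℤ) - b i) else 0
    have he1 : ∀ g, ∏ j, val j g ^ e j = 1 := by
      intro g
      obtain ⟨c, hcp, hcq⟩ := hsemi g
      have h1 := support_weight ρ P χ hP p g c hcp a ha
      have h2 := support_weight ρ P χ hP q g c hcq b hb
      have h3 : ∏ i, χ i g ^ a i = ∏ i, χ i g ^ b i := Units.ext (h1.trans h2.symm)
      have h4 : ∏ j, val j g ^ e j = ∏ i, χ i g ^ ((a i : ℤ) - b i) := by
        simp only [e, zpow_sum_aux]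
        rw [Finset.prod_comm]
        refine Finset.prod_congr rfl fun i _ => ?_
        rcases hcov i with h | ⟨j, h⟩
        · rw [h, MonoidHom.one_apply, one_zpow]
          refine Finset.prod_eq_one fun j _ => ?_
          split_ifs with h'
          · rw [← h', MonoidHom.one_apply, one_zpow]
          · exact zpow_zero _
        · rw [Finset.prod_eq_single j]
          · rw [if_pos h, h]
          · intro j' _ hj'
            rw [if_neg, zpow_zero]
            intro h'
            exact hj' (hinj (h'.symm.trans h))
          · simp
      rw [h4]
      simp only [zpow_sub, zpow_natCast]
      rw [Finset.prod_mul_distrib, h3, ← Finset.prod_mul_distrib]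
      simp
    have he2 : ∑ j, (e j).natAbs ≤ d := by
      calc ∑ j, (e j).natAbs ≤ ∑ j, ∑ i, if χ i = val j then a i + b i else 0 := by
            refine Finset.sum_le_sum fun j _ => ?_
            refine (Int.natAbs_sum_le _ _).trans (Finset.sum_le_sum fun i _ => ?_)
            split_ifs
            · omega
            · simp
        _ = ∑ i, ∑ j, if χ i = val j then a i + b i else 0 := Finset.sum_comm
        _ ≤ ∑ i, (a i + b i) := by
            refine Finset.sum_le_sum fun i _ => ?_
            by_cases h : ∃ j, χ i = val j
            · obtain ⟨j, h⟩ := h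
              rw [Finset.sum_eq_single j]
              · rw [if_pos h]
              · intro j' _ hj'
                rw [if_neg]
                intro h'
                exact hj' (hinj (h'.symm.trans h))
              · simp
            · rw [Finset.sum_eq_zero]
              · exact Nat.zero_le _
              · intro j _
                rw [if_neg]
                exact fun h' => h ⟨j, h'⟩
        _ ≤ d := by
            rw [Finset.sum_add_distrib]
            have h1 := phi_totalDegree P p a ha
            have h2 := phi_totalDegree P q b hb
            omega
    have h5 := hw e he1 he2
    have h6 : ∑ j, w j * e j = ∑ i, W i * ((a i : ℤ) - b i) := by
      simp only [e, W, Finset.mul_sum, Finset.sum_mul]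
      rw [Finset.sum_comm]
      refine Finset.sum_congr rfl fun i _ => Finset.sum_congr rfl fun j _ => ?_
      split_ifs <;> simp
    rw [h6] at h5
    simp only [mul_sub, Finset.sum_sub_distrib] at h5
    linarith
  let Φ : Lˣ → (FractionRing (MvPolynomial (Fin N) k) →+* FractionRing (MvPolynomial (Fin N) L)) :=
    fun t => Phi (P * dg W t)
  have hphi : ∀ t (p : MvPolynomial (Fin N) k), phi (P * dg W t) p =
      mAct (dg W t : Matrix (Fin N) (Fin N) L) (phi P p) := by
    intro t p
    rw [phi_apply, phi_apply, ← AlgHom.comp_apply, mAct_comp]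
    rfl
  have hLinj := IsFractionRing.injective (MvPolynomial (Fin N) L)
    (FractionRing (MvPolynomial (Fin N) L))
  have hΦs : ∀ f ∈ s, ∀ t, Φ t f = Phi P f := by
    intro f hf t
    obtain ⟨hI, p, q, hq, hrel, hfpq, hd⟩ := hs f hf
    by_cases hp : p = 0
    · rw [hfpq, hp]; simp
    have hsemi : ∀ g, ∃ c : k, mAct (ρ g : Matrix (Fin N) (Fin N) k) p = C c * p ∧
        mAct (ρ g : Matrix (Fin N) (Fin N) k) q = C c * q := by
      intro g
      refine semiinv hp hq (fun r h1 h2 => hrel r h1 h2) ?_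
      rw [← hfpq]
      exact hI g
    have hw1 := hwt p q hd hsemi
    have hp' : phi P p ≠ 0 := by rwa [ne_eq, map_eq_zero_iff _ (phi_inj P)]
    have hq' : phi P q ≠ 0 := by rwa [ne_eq, map_eq_zero_iff _ (phi_inj P)]
    obtain ⟨a₀, ha₀⟩ := ne_zero_iff.1 hp'
    obtain ⟨b₀, hb₀⟩ := ne_zero_iff.1 hq'
    have e1 := scale_eq W t (phi P p) (∑ i, W i * (b₀ i : ℤ)) (fun a ha => hw1 a b₀ ha hb₀)
    have e2 := scale_eq W t (phi P q) (∑ i, W i * (b₀ i : ℤ))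
      (fun b hb => (hw1 a₀ b ha₀ hb).symm.trans (hw1 a₀ b₀ ha₀ hb₀))
    simp only [Φ]
    rw [hfpq, map_div₀, map_div₀, Phi_algebraMap, Phi_algebraMap, Phi_algebraMap, Phi_algebraMap,
      hphi, hphi, e1, e2, map_mul, map_mul, mul_div_mul_left]
    rw [ne_eq, map_eq_zero_iff _ hLinj, C_eq_zero]
    exact Units.ne_zero _
  have hfin : ∀ i, (Set.range fun t => Φ t (algebraMap (MvPolynomial (Fin N) k)
      (FractionRing (MvPolynomial (Fin N) k)) (X i))).Finite := by
    intro i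
    refine finite_images (F := k) Φ s _ ?_ (fun f hf t t' => (hΦs f hf t).trans (hΦs f hf t').symm)
      (halg i)
    intro a t t'
    simp only [Φ]
    rw [IsScalarTower.algebraMap_apply k (MvPolynomial (Fin N) k), Phi_algebraMap, Phi_algebraMap,
      phi_apply, phi_apply, algebraMap_eq, map_C]
    simp [mAct]
  obtain ⟨j, hj⟩ := Function.ne_iff.1 hw0
  obtain ⟨i, hi⟩ := hsur j
  have hWi : W i ≠ 0 := by rw [hWj i j hi]; exact hj
  let f : Lˣ → (Fin N → FractionRing (MvPolynomial (Fin N) L)) := fun t i =>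
    Φ t (algebraMap (MvPolynomial (Fin N) k) (FractionRing (MvPolynomial (Fin N) k)) (X i))
  have hffin : (Set.range f).Finite := by
    refine (Set.Finite.pi' hfin).subset ?_
    rintro _ ⟨t, rfl⟩ i
    exact ⟨t, rfl⟩
  have hfac : Function.FactorsThrough (fun t : Lˣ => t ^ W i) f := by
    intro t t' htt
    have hrow : ∀ i l, ((P * dg W t : GL (Fin N) L) : Matrix (Fin N) (Fin N) L) i l =
        ((P * dg W t' : GL (Fin N) L) : Matrix (Fin N) (Fin N) L) i l := by
      intro i l
      have h1 := congrFun htt i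
      simp only [f, Φ] at h1
      rw [Phi_algebraMap, Phi_algebraMap] at h1
      have h2 := congrArg (coeff (Finsupp.single l 1)) (hLinj h1)
      rw [phi_apply, phi_apply, map_X] at h2
      simpa [mAct, coeff_sum, coeff_C_mul, coeff_X, Finsupp.single_left_inj] using h2
    have hQ : P * dg W t = P * dg W t' := Units.ext (by ext i l; exact hrow i l)
    have hD := mul_left_cancel hQ
    have h3 := congrArg (fun M : GL (Fin N) L => (M : Matrix (Fin N) (Fin N) L) i i) hD
    simp only [dg, Matrix.diagonal_apply_eq] at h3
    exact Units.ext h3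
  have hgfin : (Set.range fun t : Lˣ => t ^ W i).Finite := by
    obtain ⟨e, he⟩ : ∃ e : (Fin N → FractionRing (MvPolynomial (Fin N) L)) → Lˣ,
        (fun t : Lˣ => t ^ W i) = e ∘ f := (Function.factorsThrough_iff _).1 hfac
    rw [he, Set.range_comp]
    exact hffin.image _
  have hsurj : Function.Surjective fun t : Lˣ => t ^ W i := by
    have hpow : ∀ n : ℕ, 0 < n → ∀ u : Lˣ, ∃ t : Lˣ, t ^ n = u := by
      intro n hn u
      obtain ⟨z, hz⟩ := IsAlgClosed.exists_pow_nat_eq (u : L) hn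
      have hz0 : z ≠ 0 := by
        rintro rfl
        rw [zero_pow hn.ne'] at hz
        exact u.ne_zero hz.symm
      exact ⟨Units.mk0 z hz0, Units.ext (by simpa using hz)⟩
    intro u
    obtain ⟨n, hn | hn⟩ := Int.eq_nat_or_neg (W i)
    · obtain ⟨t, ht⟩ := hpow n (by omega) u
      exact ⟨t, by simp only [hn, zpow_natCast, ht]⟩
    · obtain ⟨t, ht⟩ := hpow n (by omega) u⁻¹
      exact ⟨t, by simp only [hn, zpow_neg, zpow_natCast, ht, inv_inv]⟩
  rw [hsurj.range_eq] at hgfin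
  have : Finite Lˣ := Set.finite_univ_iff.1 hgfin
  have : Finite L := by
    have h1 : (Set.range (Units.val : Lˣ → L)).Finite := Set.finite_range _
    refine Set.finite_univ_iff.1 ((h1.union (Set.finite_singleton 0)).subset ?_)
    intro x _
    by_cases hx : x = 0
    · right; exact hx
    · left; exact ⟨Units.mk0 x hx, rfl⟩
  exact not_finite L

end helper6
/-- Sharp lower bound: for a faithful representation `V` of a finite abelian
group `G` in nonmodular characteristic, with `m` the number of distinct nontrivial characters
occurring in the base change of `V` to an algebraic closure, `γ^r(G,V)^m ≥ |G|`. -/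
theorem stmt11 {k : Type} [Field k] {N : ℕ} {G : Type} [CommGroup G] [Fintype G]
    (hchar : (Fintype.card G : k) ≠ 0) (ρ : G →* GL (Fin N) k)
    (hfaithful : Function.Injective ρ) (m : ℕ)
    (hm : {χ : G →* (AlgebraicClosure k)ˣ | χ ≠ 1 ∧ Occurs (fun g => ρ g) χ}.ncard = m) :
    Fintype.card G ≤ gammaR (fun g => ρ g) ^ m := by
  classical
  let L := AlgebraicClosure k
  have hcL : (Fintype.card G : L) ≠ 0 := by
    rw [← map_natCast (algebraMap k L), ne_eq, map_eq_zero_iff _ (algebraMap k L).injective]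
    exact hchar
  have : NeZero ((Monoid.exponent G : ℕ) : k) := by
    refine ⟨fun h => hchar ?_⟩
    obtain ⟨c, hc⟩ := Group.exponent_dvd_card (G := G)
    rw [hc, Nat.cast_mul, h, zero_mul]
  have : HasEnoughRootsOfUnity L (Monoid.exponent G) :=
    AlgebraicClosure.hasEnoughRootsOfUnity k (Monoid.exponent G)
  let R : G →* Matrix (Fin N) (Fin N) L :=
    ((algebraMap k L).mapMatrix.toMonoidHom).comp ((Units.coeHom _).comp ρ)
  obtain ⟨P, χ, hP⟩ := eigen_basis (L := L) hcL R
  have hP' : ∀ g, ((ρ g : Matrix (Fin N) (Fin N) k).map (algebraMap k L)) *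
        (P : Matrix (Fin N) (Fin N) L) =
        (P : Matrix (Fin N) (Fin N) L) * Matrix.diagonal (fun i => (χ i g : L)) := hP
  let T : Set (G →* Lˣ) := {χ : G →* Lˣ | χ ≠ 1 ∧ Occurs (fun g => ρ g) χ}
  have em := (CommGroup.monoidHom_mulEquiv_of_hasEnoughRootsOfUnity G L).some
  have : Finite (G →* Lˣ) := Finite.of_equiv G em.symm.toEquiv
  have hTm : T.ncard = m := hm
  let J := T
  let _ : Fintype J := Fintype.ofFinite J
  have hJ : Fintype.card J = m := by
    rw [← hTm, ← Nat.card_coe_set_eq, Nat.card_eq_fintype_card]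
  have hPinj : ∀ v : Fin N → L, (P : Matrix (Fin N) (Fin N) L).mulVec v = 0 → v = 0 := by
    intro v hv
    have := congrArg (((P⁻¹ : GL (Fin N) L) : Matrix (Fin N) (Fin N) L).mulVec) hv
    rwa [Matrix.mulVec_mulVec, Units.inv_mul, Matrix.one_mulVec, Matrix.mulVec_zero] at this
  have hocc : ∀ i, Occurs (fun g => ρ g) (χ i) := by
    intro i
    refine ⟨(P : Matrix (Fin N) (Fin N) L).mulVec (Pi.single i 1), ?_, fun g => ?_⟩
    · intro h
      have := congrFun (hPinj _ h) i
      simp at this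
    · rw [Matrix.mulVec_mulVec, hP', ← Matrix.mulVec_mulVec, Matrix.diagonal_mulVec_single,
        mul_one, ← Matrix.mulVec_smul]
      congr 1
      ext j
      simp [Pi.single_apply]
  have hsur : ∀ j : J, ∃ i, χ i = j.1 := by
    rintro ⟨ψ, hψ1, v, hv0, hv⟩
    let c := ((P⁻¹ : GL (Fin N) L) : Matrix (Fin N) (Fin N) L).mulVec v
    have hvc : (P : Matrix (Fin N) (Fin N) L).mulVec c = v := by
      rw [Matrix.mulVec_mulVec, Units.mul_inv, Matrix.one_mulVec]
    have hc0 : c ≠ 0 := by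
      intro h
      rw [h, Matrix.mulVec_zero] at hvc
      exact hv0 hvc.symm
    obtain ⟨i, hi⟩ := Function.ne_iff.1 hc0
    refine ⟨i, MonoidHom.ext fun g => Units.ext ?_⟩
    have h1 := hv g
    rw [← hvc, Matrix.mulVec_mulVec, hP', ← Matrix.mulVec_mulVec, ← Matrix.mulVec_smul,
      ← sub_eq_zero, ← Matrix.mulVec_sub] at h1
    have h2 := congrFun (hPinj _ h1) i
    rw [Pi.sub_apply, Matrix.mulVec_diagonal, Pi.smul_apply, smul_eq_mul, Pi.zero_apply,
      sub_eq_zero] at h2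
    exact mul_right_cancel₀ hi h2
  have hcov : ∀ i, χ i = 1 ∨ ∃ j : J, χ i = j.1 := by
    intro i
    by_cases h : χ i = 1
    · exact Or.inl h
    · exact Or.inr ⟨⟨χ i, h, hocc i⟩, rfl⟩
  have hsep : ∀ g, (∀ j : J, j.1 g = 1) → g = 1 := by
    intro g hg
    have hd : Matrix.diagonal (fun i => (χ i g : L)) = 1 := by
      rw [← Matrix.diagonal_one]
      congr 1
      funext i
      rcases hcov i with h | ⟨j, h⟩
      · rw [h]; rfl
      · rw [h, hg j]; rfl
    have h1 := hP' g
    rw [hd, mul_one] at h1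
    have h2 : (ρ g : Matrix (Fin N) (Fin N) k).map (algebraMap k L) = 1 := by
      have h3 := congrArg (· * ((P⁻¹ : GL (Fin N) L) : Matrix (Fin N) (Fin N) L)) h1
      simpa only [mul_assoc, Units.mul_inv, mul_one] using h3
    apply hfaithful
    rw [map_one]
    refine Units.ext ?_
    refine Matrix.map_injective (algebraMap k L).injective ?_
    refine h2.trans ?_
    simp only [Units.val_one]
    rw [Matrix.map_one _ (map_zero _) (map_one _)]
  let Λ : AddSubgroup (J → ℤ) :=
    { carrier := {e | ∀ g, ∏ j : J, j.1 g ^ e j = 1}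
      zero_mem' := by intro g; simp
      add_mem' := by
        intro a b ha hb g
        simp only [Pi.add_apply, zpow_add, Finset.prod_mul_distrib]
        rw [ha g, hb g, one_mul]
      neg_mem' := by
        intro a ha g
        simp only [Pi.neg_apply, zpow_neg, Finset.prod_inv_distrib]
        rw [ha g, inv_one] }
  have hidx : Fintype.card G ≤ Λ.index :=
    card_le_index (fun j : J => j.1) hsep Λ (fun e => Iff.rfl)
  by_contra hlt
  have hmem := Nat.sInf_mem (gamma_nonempty ρ)
  obtain ⟨s, hs, -, halg⟩ := hmem
  obtain ⟨w, hw0, hw⟩ := lattice_alt Λ (gammaR (fun g => ρ g)) (by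
    rw [hJ]; omega)
  exact core ρ P χ hP' (fun j : J => j.1) Subtype.val_injective hcov hsur
    (gammaR (fun g => ρ g)) s hs (X_alg ρ s halg) w hw0 hw
end
end
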